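/- arXiv:2509.11256 — 3 statements merged into one kernel-verified Lean document; each statement's English description precedes it below -/
import Mathlib

section
/- Let S be a second-countable, locally compact Hausdorff topological space equipped with its Borel σ-algebra, and let μ be a Borel measure on S that is finite on every compact subset and takes values in ℕ ∪ {∞} on every Borel set. Then there exist a finite or countably infinite index set I, points (σ_i)_{i∈I} in S, and positive integers (β_i)_{i∈I} such that μ = ∑_{i∈I} β_i · δ_{σ_i}, where δ_x denotes the Dirac measure at x. -/
open MeasureTheory

/-- If an outer regular measure on a second-countable space takes no value in `(0, 1)` on open sets,
then the set of points of mass zero is null. -/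
theorem MeasureTheory.Measure.measure_setOf_singleton_eq_zero
    {S : Type*} [TopologicalSpace S] [SecondCountableTopology S] [MeasurableSpace S]
    (μ : Measure S) [μ.OuterRegular]
    (h : ∀ U : Set S, IsOpen U → μ U < 1 → μ U = 0) :
    μ {x | μ {x} = 0} = 0 := by
  refine measure_null_of_locally_null _ fun x hx => ?_
  obtain ⟨U, hxU, hU, hμU⟩ := Set.exists_isOpen_lt_of_lt {x} 1
    (lt_of_eq_of_lt (show μ {x} = 0 from hx) one_pos)
  exact ⟨U, mem_nhdsWithin_of_mem_nhds (hU.mem_nhds (hxU rfl)), h U hU hμU⟩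

/-- Any integer-valued Radon (Borel) measure on a second-countable,
locally compact Hausdorff space is a finite or countably infinite sum of positive
integer multiples of Dirac measures. -/
theorem integer_valued_radon_measure_is_sum_of_diracs
    {S : Type*} [TopologicalSpace S] [SecondCountableTopology S]
    [LocallyCompactSpace S] [T2Space S]
    [MeasurableSpace S] [BorelSpace S]
    (μ : Measure S)
    (hRadon : ∀ K : Set S, IsCompact K → μ K < ⊤)
    (hInt : ∀ B : Set S, MeasurableSet B → μ B = ⊤ ∨ ∃ n : ℕ, μ B = n) :
    ∃ (I : Type) (_ : Countable I) (σ : I → S) (β : I → ℕ),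
      (∀ i, 0 < β i) ∧
      μ = Measure.sum (fun i => (β i : ENNReal) • Measure.dirac (σ i)) := by
  have : IsFiniteMeasureOnCompacts μ := ⟨fun K hK => hRadon K hK⟩
  have hnull : μ {x | μ {x} = 0} = 0 := by
    refine μ.measure_setOf_singleton_eq_zero fun U hU hlt => ?_
    obtain h | ⟨n, hn⟩ := hInt U hU.measurableSet
    · simp [h] at hlt
    · rw [hn] at hlt ⊢
      exact_mod_cast Nat.lt_one_iff.mp (by exact_mod_cast hlt)
  let A : Set S := {x | 0 < μ {x}}
  have hA : A.Countable := Measure.countable_meas_pos_of_disjoint_iUnion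
    (fun x => measurableSet_singleton x) (fun x y hxy => Set.disjoint_singleton.mpr hxy)
  have : Countable A := hA
  obtain ⟨f, hf⟩ := exists_injective_nat A
  let e := Equiv.ofInjective f hf
  have hmass (x : S) : ∃ n : ℕ, μ {x} = n :=
    (hInt {x} (measurableSet_singleton x)).resolve_left (hRadon {x} isCompact_singleton).ne
  choose m hm using hmass
  refine ⟨Set.range f, inferInstance, fun i => e.symm i, fun i => m (e.symm i), fun i => ?_, ?_⟩
  · have h : 0 < μ {(e.symm i : S)} := (e.symm i).2
    rw [hm] at h
    exact_mod_cast h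
  · have hUnion : ⋃ i, {(e.symm i : S)} = A := by
      rw [e.symm.surjective.iUnion_comp (fun a : A => {(a : S)}), Set.iUnion_of_singleton_coe]
    have hrestrict : μ.restrict A = μ :=
      Measure.restrict_eq_self_of_ae_mem <| by
        simpa [ae_iff, A] using hnull
    conv_lhs => rw [← hrestrict, ← hUnion]
    rw [Measure.restrict_iUnion (fun i j hij => Set.disjoint_singleton.mpr fun h =>
      hij (e.symm.injective (Subtype.ext h))) (fun i => measurableSet_singleton _)]
    simp only [Measure.restrict_singleton, hm]
end

section
/- Fix an integer q ≥ 1. Define f : ℝ → ℝ by f(x) = (x−1)(x−2)⋯(x−q−1)/(q+1)! if x > q+1, and f(x) = 0 if x ≤ q+1. Then f is convex on the interval [0,∞). -/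
/-- A finite product of nonnegative monotone convex functions on the line is convex. -/
theorem convexOn_prod_of_monotone {ι : Type*} (s : Finset ι) (g : ι → ℝ → ℝ)
    (hconv : ∀ i ∈ s, ConvexOn ℝ Set.univ (g i)) (hnonneg : ∀ i ∈ s, ∀ x, 0 ≤ g i x)
    (hmono : ∀ i ∈ s, Monotone (g i)) :
    ConvexOn ℝ Set.univ (fun x => ∏ i ∈ s, g i x) := by
  classical
  induction s using Finset.induction_on with
  | empty => simpa using convexOn_const (1 : ℝ) (convex_univ (𝕜 := ℝ) (E := ℝ))
  | insert a s ha ih =>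
    simp only [Finset.forall_mem_insert] at hconv hnonneg hmono
    simp only [Finset.prod_insert ha]
    have hprod : Monotone (fun x => ∏ i ∈ s, g i x) := fun x y hxy =>
      Finset.prod_le_prod (fun i hi => hnonneg.2 i hi x) (fun i hi => hmono.2 i hi hxy)
    exact hconv.1.mul (ih hconv.2 hnonneg.2 hmono.2) (fun x _ => hnonneg.1 x)
      (fun x _ => Finset.prod_nonneg fun i hi => hnonneg.2 i hi x)
      ((hmono.1.monovary hprod).monovaryOn _)

/-- The shifted positive part `x ↦ max (x - c) 0` is convex. -/
theorem convexOn_max_sub_zero (c : ℝ) : ConvexOn ℝ Set.univ (fun x : ℝ => max (x - c) 0) :=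
  ((convexOn_id convex_univ).sub (concaveOn_const c convex_univ)).sup
    (convexOn_const 0 convex_univ)

/-- For an integer `q ≥ 1`, the function
`f(x) = (x−1)(x−2)⋯(x−q−1)/(q+1)!` for `x > q+1` and `f(x) = 0` otherwise
is convex on `[0,∞)`. -/
theorem convexOn_truncated_binomial (q : ℕ) (hq : 1 ≤ q) :
    ConvexOn ℝ (Set.Ici (0 : ℝ))
      (fun x : ℝ =>
        if (q : ℝ) + 1 < x then
          (∏ i ∈ Finset.Icc 1 (q + 1), (x - (i : ℝ))) / ((q + 1).factorial : ℝ)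
        else 0) := by
  have hprod := convexOn_prod_of_monotone (Finset.Icc 1 (q + 1))
    (fun (i : ℕ) (x : ℝ) => max (x - (i : ℝ)) 0) (fun i _ => convexOn_max_sub_zero i)
    (fun i _ x => le_max_right _ _)
    (fun i _ x y hxy => max_le_max (sub_le_sub_right hxy _) le_rfl)
  have hscaled := (hprod.smul (c := ((q + 1).factorial : ℝ)⁻¹) (by positivity)).subset
    (Set.subset_univ (Set.Ici 0)) (convex_Ici 0)
  refine hscaled.congr fun x _ => ?_
  simp only [smul_eq_mul]
  split_ifs with hx
  · rw [div_eq_inv_mul]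
    congr 1
    refine Finset.prod_congr rfl fun i hi => max_eq_left ?_
    have hi' : (i : ℝ) ≤ q + 1 := by exact_mod_cast (Finset.mem_Icc.mp hi).2
    linarith
  · rw [Finset.prod_eq_zero (i := q + 1) (by simp), mul_zero]
    push_cast
    exact max_eq_right (by linarith)
end

section
/- Let N ≥ 1 be an integer and let Ξ and Ξ' be nonempty finite subsets of ℝ^N with the same cardinality. Assume that d_H(Ξ, Ξ') < (1/2)·‖x − x'‖ for every pair of distinct points x, x' ∈ Ξ. Then there exists a bijection f : Ξ → Ξ' such that ‖x − f(x)‖ ≤ d_H(Ξ, Ξ') for every x ∈ Ξ. -/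
/-- Every point of a nonempty bounded set `s` has a point of the nonempty compact set `t` within
the Hausdorff distance of `s` and `t`. -/
theorem IsCompact.exists_dist_le_hausdorffDist {α : Type*} [PseudoMetricSpace α] {s t : Set α}
    (ht : IsCompact t) (htn : t.Nonempty) (hs : Bornology.IsBounded s) {x : α} (hx : x ∈ s) :
    ∃ y ∈ t, dist x y ≤ Metric.hausdorffDist s t := by
  obtain ⟨y, hy, hxy⟩ := ht.exists_infDist_eq_dist htn x
  refine ⟨y, hy, hxy ▸ Metric.infDist_le_hausdorffDist_of_mem hx ?_⟩
  exact Metric.hausdorffEDist_ne_top_of_nonempty_of_bounded ⟨x, hx⟩ htn hs ht.isBounded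

/-- If `Ξ, Ξ'` are nonempty finite subsets of `ℝ^N` of the same
cardinality, and the Hausdorff distance `d_H(Ξ,Ξ')` is less than half the minimal
pairwise distance between distinct points of `Ξ`, then there is a bijection
`f : Ξ → Ξ'` moving every point by at most `d_H(Ξ,Ξ')`. -/
theorem exists_bijection_of_hausdorffDist_lt_half_separation (N : ℕ) (hN : 1 ≤ N)
    (Ξ Ξ' : Set (EuclideanSpace ℝ (Fin N)))
    (hΞf : Ξ.Finite) (hΞn : Ξ.Nonempty) (hΞ'f : Ξ'.Finite) (hΞ'n : Ξ'.Nonempty)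
    (hcard : Ξ.ncard = Ξ'.ncard)
    (hsep : ∀ x ∈ Ξ, ∀ x' ∈ Ξ, x ≠ x' →
      Metric.hausdorffDist Ξ Ξ' < (1 / 2) * ‖x - x'‖) :
    ∃ f : EuclideanSpace ℝ (Fin N) → EuclideanSpace ℝ (Fin N),
      Set.BijOn f Ξ Ξ' ∧ ∀ x ∈ Ξ, ‖x - f x‖ ≤ Metric.hausdorffDist Ξ Ξ' := by
  have hnear : ∀ x, ∃ y, x ∈ Ξ → y ∈ Ξ' ∧ dist x y ≤ Metric.hausdorffDist Ξ Ξ' := by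
    intro x
    by_cases hx : x ∈ Ξ
    · obtain ⟨y, hy, hxy⟩ :=
        hΞ'f.isCompact.exists_dist_le_hausdorffDist hΞ'n hΞf.isBounded hx
      exact ⟨y, fun _ => ⟨hy, hxy⟩⟩
    · exact ⟨x, fun h => absurd h hx⟩
  choose f hf using hnear
  have hmaps : Set.MapsTo f Ξ Ξ' := fun x hx => (hf x hx).1
  have hinj : Set.InjOn f Ξ := by
    intro x hx x' hx' hxx'
    by_contra hne
    have hlt := hsep x hx x' hx' hne
    have hle := (hf x hx).2
    have hle' := (hf x' hx').2
    rw [← hxx'] at hle'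
    rw [← dist_eq_norm] at hlt
    linarith [dist_triangle_right x x' (f x)]
  have himage : f '' Ξ = Ξ' :=
    Set.eq_of_subset_of_ncard_le hmaps.image_subset
      (by rw [hinj.ncard_image, hcard]) hΞ'f
  exact ⟨f, ⟨hmaps, hinj, himage.ge⟩, fun x hx => dist_eq_norm x (f x) ▸ (hf x hx).2⟩
end
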